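/- Let N be a positive integer such that v_p(N) ≤ 2 for every odd prime p and v_2(N) ≤ 3, and let G be a nilpotent group of order N. Then a_d(G) = a_{N/d}(G) holds for every positive divisor d of N (the symmetry ζ_G(s) = N^{-s} ζ_G(-s)) if and only if G is abelian. -/

import Mathlib

/-- `subCount G m` is the number of subgroups of `G` of order `m`,
i.e. the coefficient `a_m(G)` of the zeta function `ζ_G(s) = Σ_m a_m(G) m^{-s}`. -/
noncomputable def subCount (G : Type*) [Group G] (m : ℕ) : ℕ :=
  Nat.card {H : Subgroup G // Nat.card H = m}

open Subgroup
open scoped commutatorElement IsMulCommutative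

theorem subCount_congr {G G' : Type*} [Group G] [Group G'] (e : G ≃* G') (m : ℕ) :
    subCount G m = subCount G' m :=
  Nat.card_congr <| e.mapSubgroup.toEquiv.subtypeEquiv fun H ↦ by
    have : Nat.card (H.map e.toMonoidHom) = Nat.card H :=
      Subgroup.card_map_of_injective e.injective
    change Nat.card H = m ↔ Nat.card (H.map e.toMonoidHom) = m
    rw [this]

theorem subCount_eq_subCount_div_of_commGroup {G : Type*} [CommGroup G] [Finite G] {d : ℕ}
    (hd : d ∣ Nat.card G) : subCount G d = subCount G (Nat.card G / d) := by
  have : NeZero (Monoid.exponent G) := ⟨Monoid.exponent_ne_zero_of_finite⟩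
  rw [← subCount_congr
    (CommGroup.monoidHom_mulEquiv_of_hasEnoughRootsOfUnity G (AlgebraicClosure ℚ)).some
    (Nat.card G / d)]
  refine Nat.card_congr <| (CommGroup.subgroupOrderIsoSubgroupMonoidHom G
    (AlgebraicClosure ℚ)).toEquiv.subtypeEquiv fun H ↦ ?_
  have hH := CommGroup.card_subgroupOrderIsoSubgroupMonoidHom (G := G) (AlgebraicClosure ℚ) H
  change _ ↔ Nat.card (CommGroup.subgroupOrderIsoSubgroupMonoidHom G
    (AlgebraicClosure ℚ) H).ofDual = _
  rw [hH]
  have hmul := H.card_eq_card_quotient_mul_card_subgroup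
  have hpos : 0 < Nat.card (G ⧸ H) := Nat.card_pos
  have hposH : 0 < Nat.card H := Nat.card_pos
  obtain ⟨e, he⟩ := hd
  have hd0 : 0 < d := Nat.pos_of_ne_zero fun h ↦
    (Nat.card_pos (α := G)).ne' (by rw [he, h, zero_mul])
  rw [he, Nat.mul_div_cancel_left _ hd0]
  rw [he] at hmul
  constructor
  · rintro rfl
    exact Nat.eq_of_mul_eq_mul_right hposH (by linarith)
  · rintro h
    rw [h] at hmul hpos
    exact (Nat.eq_of_mul_eq_mul_right hpos (by linarith)).symm

section Nilpotent

variable {G : Type*} [Group G] [Finite G] [Group.IsNilpotent G] {p : ℕ} [Fact p.Prime]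

theorem map_center_sylow_le_center (P : Sylow p G) :
    (center P).map (P : Subgroup G).subtype ≤ center G := by
  rintro _ ⟨x, hx, rfl⟩
  have hnormal : ∀ (q : ℕ) [Fact q.Prime] (Q : Sylow q G), (Q : Subgroup G).Normal :=
    fun q _ Q ↦ ((Group.isNilpotent_of_finite_tfae (G := G)).out 0 3 rfl rfl).mp ‹_› q ‹_› Q
  have hle : ∀ (q : ℕ) [Fact q.Prime] (Q : Sylow q G),
      (Q : Subgroup G) ≤ centralizer {(x : G)} := by
    intro q hq Q y hy
    rw [mem_centralizer_singleton_iff]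
    by_cases hpq : q = p
    · subst hpq
      have : Unique (Sylow q G) := Sylow.unique_of_normal P (hnormal q P)
      obtain rfl := Subsingleton.elim P Q
      exact congrArg Subtype.val (mem_center_iff.mp hx ⟨y, hy⟩)
    · exact commute_of_normal_of_disjoint _ _ (hnormal q Q) (hnormal p P)
        (IsPGroup.disjoint_of_ne q p hpq _ _ Q.isPGroup' P.isPGroup') y x hy x.2
  have htop : centralizer {(x : G)} = ⊤ := by
    rw [← index_eq_one]
    by_contra h
    obtain ⟨q, hq, hqd⟩ := Nat.exists_prime_and_dvd h
    have : Fact q.Prime := ⟨hq⟩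
    let Q : Sylow q G := default
    exact Q.not_dvd_index (hqd.trans (index_dvd_of_le (hle q Q)))
  rw [coe_subtype, mem_center_iff]
  intro g
  exact mem_centralizer_singleton_iff.mp (htop ▸ mem_top g)

theorem prime_dvd_card_center_of_dvd_card (hp : p ∣ Nat.card G) : p ∣ Nat.card (center G) := by
  let P : Sylow p G := default
  have hP : p ∣ Nat.card P := P.dvd_card_of_dvd_card hp
  have : Nontrivial P := by
    rw [← Finite.one_lt_card_iff_nontrivial]
    exact lt_of_lt_of_le (Fact.out : p.Prime).one_lt (Nat.le_of_dvd Nat.card_pos hP)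
  have := P.isPGroup'.center_nontrivial
  obtain ⟨n, hn, hcard⟩ := (P.isPGroup'.to_subgroup (center P)).nontrivial_iff_card.mp this
  have h := card_dvd_of_le (map_center_sylow_le_center P)
  rw [card_map_of_injective (P : Subgroup G).subtype_injective, hcard] at h
  exact (dvd_pow_self p hn.ne').trans h

theorem not_dvd_index_center_of_factorization_le_two (h : (Nat.card G).factorization p ≤ 2) :
    ¬ p ∣ (center G).index := by
  let P : Sylow p G := default
  have hcard : Nat.card P = p ^ (Nat.card G).factorization p := P.card_eq_multiplicity
  have hcomm : IsMulCommutative P := by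
    interval_cases (Nat.card G).factorization p
    · have : Subsingleton P := (Nat.card_eq_one_iff_unique.mp (by simpa using hcard)).1
      exact ⟨⟨fun _ _ ↦ Subsingleton.elim _ _⟩⟩
    · have := isCyclic_of_prime_card (α := P) (p := p) (by simpa using hcard)
      infer_instance
    · exact IsPGroup.isMulCommutative_of_card_eq_prime_sq hcard
  have hle : (P : Subgroup G) ≤ center G := fun x hx ↦
    map_center_sylow_le_center P ⟨⟨x, hx⟩, mem_center_iff.mpr fun y ↦ hcomm.is_comm.comm _ _, rfl⟩
  exact fun hd ↦ P.not_dvd_index (hd.trans (index_dvd_of_le hle))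

end Nilpotent

theorem index_center_dvd_four {G : Type*} [Group G] [Finite G] [Group.IsNilpotent G]
    (hodd : ∀ p : ℕ, p.Prime → Odd p → (Nat.card G).factorization p ≤ 2)
    (h2 : (Nat.card G).factorization 2 ≤ 3) : (center G).index ∣ 4 := by
  have hi : (center G).index ≠ 0 := index_ne_zero_of_finite
  have hZ : Nat.card (center G) ≠ 0 := Nat.card_pos.ne'
  rw [← Nat.factorization_prime_le_iff_dvd hi (by norm_num)]
  intro p hp
  have : Fact p.Prime := ⟨hp⟩
  by_cases h : (Nat.card G).factorization p ≤ 2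
  · rw [Nat.factorization_eq_zero_of_not_dvd (not_dvd_index_center_of_factorization_le_two h)]
    exact Nat.zero_le _
  · obtain rfl : p = 2 := hp.eq_two_or_odd'.resolve_right fun ho ↦ h (hodd p hp ho)
    have hdvd : 2 ∣ Nat.card (center G) := prime_dvd_card_center_of_dvd_card <| by
      by_contra hn
      simp [Nat.factorization_eq_zero_of_not_dvd hn] at h
    have hpos := hp.factorization_pos_of_dvd hZ hdvd
    have hfac : (Nat.card G).factorization 2 =
        (Nat.card (center G)).factorization 2 + (center G).index.factorization 2 := by
      rw [← (center G).card_mul_index, Nat.factorization_mul hZ hi, Finsupp.add_apply]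
    have h4 : Nat.factorization 4 2 = 2 := by
      rw [show 4 = 2 ^ 2 by norm_num, Nat.Prime.factorization_pow hp]; simp
    omega

theorem eq_of_sq_eq_one_of_card_eq_two_mul_odd {A : Type*} [CommGroup A] {m : ℕ}
    (hm : Odd m) (hA : Nat.card A = 2 * m) {s t : A} (hs1 : s ≠ 1) (hs : s ^ 2 = 1)
    (ht1 : t ≠ 1) (ht : t ^ 2 = 1) : s = t := by
  have hs2 : orderOf s = 2 := orderOf_eq_prime hs hs1
  have hcard : Nat.card (A ⧸ zpowers s) = m := by
    have h := (zpowers s).card_eq_card_quotient_mul_card_subgroup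
    rw [Nat.card_zpowers, hs2, hA] at h
    omega
  have ht' : (t : A ⧸ zpowers s) = 1 := by
    rw [← orderOf_eq_one_iff]
    refine Nat.eq_one_of_dvd_coprimes hm.coprime_two_left ?_ ?_
    · exact orderOf_dvd_of_pow_eq_one (by rw [← QuotientGroup.mk_pow, ht, QuotientGroup.mk_one])
    · exact hcard ▸ orderOf_dvd_natCard _
  obtain ⟨k, rfl⟩ := mem_zpowers_iff.mp ((QuotientGroup.eq_one_iff t).mp ht')
  rcases Int.even_or_odd' k with ⟨j, rfl | rfl⟩
  · exact absurd (by rw [zpow_mul, zpow_ofNat, hs, one_zpow]) ht1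
  · rw [zpow_add, zpow_mul, zpow_ofNat, hs, one_zpow, one_mul, zpow_one]

theorem subCount_two (G : Type*) [Group G] :
    subCount G 2 = Nat.card {g : G // orderOf g = 2} := by
  symm
  refine Nat.card_congr (Equiv.ofBijective
    (fun g ↦ ⟨zpowers g.1, (Nat.card_zpowers g.1).trans g.2⟩) ⟨?_, ?_⟩)
  · rintro ⟨g, hg⟩ ⟨h, hh⟩ hgh
    have hgh : zpowers g = zpowers h := congrArg Subtype.val hgh
    obtain ⟨hg2, hg1⟩ := orderOf_eq_prime_iff.mp hg
    obtain ⟨hh2, -⟩ := orderOf_eq_prime_iff.mp hh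
    obtain ⟨k, hk⟩ := mem_zpowers_iff.mp (hgh ▸ mem_zpowers g)
    rcases Int.even_or_odd' k with ⟨j, rfl | rfl⟩
    · exact absurd (by rw [← hk, zpow_mul, zpow_ofNat, hh2, one_zpow]) hg1
    · rw [zpow_add, zpow_mul, zpow_ofNat, hh2, one_zpow, one_mul, zpow_one] at hk
      exact Subtype.ext hk.symm
  · rintro ⟨H, hH⟩
    have : IsCyclic H := isCyclic_of_prime_card (p := 2) hH
    obtain ⟨g, hg⟩ := IsCyclic.exists_ofOrder_eq_natCard (α := H)
    have hfin : Finite H := Nat.finite_of_card_ne_zero (by omega)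
    have hgo : orderOf (g : G) = 2 := by rw [orderOf_coe, hg, hH]
    refine ⟨⟨g, hgo⟩, Subtype.ext (eq_of_le_of_card_ge (zpowers_le.mpr g.2) ?_)⟩
    rw [Nat.card_zpowers, hgo, hH]

section CenterIndex

variable {G : Type*} [Group G] {a b : G}

theorem index_centralizer_eq_two (h4 : (center G).index ∣ 4) (hab : ¬ Commute a b) :
    (centralizer {a}).index = 2 := by
  have hle : center G ≤ centralizer {a} := center_le_centralizer _
  have hmul := relIndex_mul_index hle
  have h1 : (centralizer {a}).index ≠ 1 := fun h ↦ hab <|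
    (mem_centralizer_singleton_iff.mp (index_eq_one.mp h ▸ mem_top b)).symm
  have h2 : (center G).relIndex (centralizer {a}) ≠ 1 := fun h ↦ hab <|
    (mem_center_iff.mp (relIndex_eq_one.mp h (mem_centralizer_singleton_iff.mpr rfl)) b).symm
  have hd := h4
  rw [← hmul] at hd
  have h3 := Nat.le_of_dvd (by norm_num) hd
  have h5 : 0 < (center G).relIndex (centralizer {a}) * (centralizer {a}).index :=
    Nat.pos_of_dvd_of_pos hd (by norm_num)
  have h6 := Nat.pos_of_mul_pos_left h5
  have h7 := Nat.pos_of_mul_pos_right h5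
  have h8 : 2 ≤ (center G).relIndex (centralizer {a}) := by omega
  nlinarith [show 2 ≤ (centralizer {a}).index by omega]

theorem mem_center_of_commute (h4 : (center G).index ∣ 4) (hab : ¬ Commute a b) {g : G}
    (hga : Commute g a) (hgb : Commute g b) : g ∈ center G := by
  have hle : center G ≤ centralizer {a} ⊓ centralizer {b} :=
    le_inf (center_le_centralizer _) (center_le_centralizer _)
  have hmul := relIndex_mul_index hle
  have hmul' := relIndex_mul_index (inf_le_left : centralizer {a} ⊓ centralizer {b} ≤ _)
  have h1 : (centralizer {a} ⊓ centralizer {b}).relIndex (centralizer {a}) ≠ 1 := fun h ↦ hab <|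
    mem_centralizer_singleton_iff.mp
      (relIndex_eq_one.mp h (mem_centralizer_singleton_iff.mpr rfl)).2
  rw [index_centralizer_eq_two h4 hab] at hmul'
  have hpos : 0 < (center G).index := Nat.pos_of_dvd_of_pos h4 (by norm_num)
  have h3 := Nat.le_of_dvd (by norm_num) h4
  have hone : (center G).relIndex (centralizer {a} ⊓ centralizer {b}) = 1 := by
    rw [← hmul] at hpos h3
    have h6 := Nat.pos_of_mul_pos_left hpos
    have h7 := Nat.pos_of_mul_pos_right hpos
    have h8 : 4 ≤ (centralizer {a} ⊓ centralizer {b}).index := by omega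
    nlinarith
  exact relIndex_eq_one.mp hone
    ⟨mem_centralizer_singleton_iff.mpr hga, mem_centralizer_singleton_iff.mpr hgb⟩

theorem index_center_eq_four (h4 : (center G).index ∣ 4) (hab : ¬ Commute a b) :
    (center G).index = 4 := by
  have hd := index_dvd_of_le (center_le_centralizer ({a} : Set G))
  rw [index_centralizer_eq_two h4 hab] at hd
  have hne : (center G).index ≠ 2 := fun h ↦ by
    have hmul := relIndex_mul_index (center_le_centralizer ({a} : Set G))
    rw [index_centralizer_eq_two h4 hab, h] at hmul
    exact hab (mem_center_iff.mp (relIndex_eq_one.mp (by omega)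
      (mem_centralizer_singleton_iff.mpr rfl)) b).symm
  have h3 := Nat.le_of_dvd (by norm_num) h4
  have hpos : 0 < (center G).index := Nat.pos_of_dvd_of_pos h4 (by norm_num)
  interval_cases (center G).index <;> omega

theorem sq_mem_center (h4 : (center G).index ∣ 4) (hab : ¬ Commute a b) (g : G) :
    g ^ 2 ∈ center G :=
  mem_center_of_commute h4 hab
    (mem_centralizer_singleton_iff.mp
      (sq_mem_of_index_two (index_centralizer_eq_two h4 hab) g))
    (mem_centralizer_singleton_iff.mp
      (sq_mem_of_index_two (index_centralizer_eq_two h4 fun h ↦ hab h.symm) g))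

theorem exists_mul_mem_center (h4 : (center G).index ∣ 4) (hab : ¬ Commute a b) (g : G) :
    ∃ x, (x = 1 ∨ x = a ∨ x = b ∨ x = a * b) ∧ g * x ∈ center G := by
  have hA := index_centralizer_eq_two h4 hab
  have hB := index_centralizer_eq_two h4 fun h ↦ hab h.symm
  have key : ∀ x, (g * x ∈ centralizer {a}) → (g * x ∈ centralizer {b}) → g * x ∈ center G :=
    fun x h h' ↦ mem_center_of_commute h4 hab (mem_centralizer_singleton_iff.mp h)
      (mem_centralizer_singleton_iff.mp h')
  have haa : a ∈ centralizer {a} := mem_centralizer_singleton_iff.mpr rfl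
  have hbb : b ∈ centralizer {b} := mem_centralizer_singleton_iff.mpr rfl
  have hba : b ∉ centralizer {a} := fun h ↦ hab (mem_centralizer_singleton_iff.mp h).symm
  have hab' : a ∉ centralizer {b} := fun h ↦ hab (mem_centralizer_singleton_iff.mp h)
  by_cases hga : g ∈ centralizer {a} <;> by_cases hgb : g ∈ centralizer {b}
  · exact ⟨1, by simp, key _ (by simpa using hga) (by simpa using hgb)⟩
  · refine ⟨a, by simp, key _ ?_ ?_⟩ <;> simp_all [mul_mem_iff_of_index_two]
  · refine ⟨b, by simp, key _ ?_ ?_⟩ <;> simp_all [mul_mem_iff_of_index_two]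
  · refine ⟨a * b, by simp, key _ ?_ ?_⟩ <;> simp_all [mul_mem_iff_of_index_two]

theorem commutatorElement_mem_of_index_two {H : Subgroup G} (hH : H.index = 2) (a b : G) :
    ⁅a, b⁆ ∈ H := by
  rw [commutatorElement_def]
  simp only [mul_mem_iff_of_index_two hH, inv_mem_iff]
  tauto

theorem commutatorElement_mem_center (h4 : (center G).index ∣ 4) (hab : ¬ Commute a b) :
    ⁅a, b⁆ ∈ center G :=
  mem_center_of_commute h4 hab
    (mem_centralizer_singleton_iff.mp
      (commutatorElement_mem_of_index_two (index_centralizer_eq_two h4 hab) a b))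
    (mem_centralizer_singleton_iff.mp (commutatorElement_mem_of_index_two
      (index_centralizer_eq_two h4 fun h ↦ hab h.symm) a b))

theorem commutatorElement_ne_one (hab : ¬ Commute a b) : ⁅a, b⁆ ≠ 1 :=
  fun h ↦ hab (commutatorElement_eq_one_iff_commute.mp h)

theorem commutatorElement_sq_eq_one (h4 : (center G).index ∣ 4) (hab : ¬ Commute a b) :
    ⁅a, b⁆ ^ 2 = 1 := by
  have hz := mem_center_iff.mp (commutatorElement_mem_center h4 hab)
  have ha := mem_center_iff.mp (sq_mem_center h4 hab a) b
  have hc : a * b = ⁅a, b⁆ * (b * a) := by rw [commutatorElement_def]; group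
  have : ⁅a, b⁆ ^ 2 * (b * a ^ 2) = b * a ^ 2 :=
    calc ⁅a, b⁆ ^ 2 * (b * a ^ 2)
      _ = ⁅a, b⁆ * (⁅a, b⁆ * (b * a)) * a := by simp only [pow_two, mul_assoc]
      _ = ⁅a, b⁆ * a * (b * a) := by rw [← hc]; simp only [mul_assoc]
      _ = a * ⁅a, b⁆ * (b * a) := by rw [hz]
      _ = a * (a * b) := by rw [mul_assoc, ← hc]
      _ = b * a ^ 2 := by rw [ha, pow_two, mul_assoc]
  exact mul_eq_right.mp this

variable {m : ℕ}

theorem eq_of_mem_center_of_sq_eq_one (hm : Odd m) (hZ : Nat.card (center G) = 2 * m) {s t : G}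
    (hs : s ∈ center G) (ht : t ∈ center G) (hs1 : s ≠ 1) (ht1 : t ≠ 1)
    (hs2 : s ^ 2 = 1) (ht2 : t ^ 2 = 1) : s = t :=
  congrArg Subtype.val <| eq_of_sq_eq_one_of_card_eq_two_mul_odd hm hZ
    (s := (⟨s, hs⟩ : center G)) (t := ⟨t, ht⟩) (fun h ↦ hs1 (congrArg Subtype.val h))
    (Subtype.ext hs2) (fun h ↦ ht1 (congrArg Subtype.val h)) (Subtype.ext ht2)

theorem pow_two_mul_eq_one_of_mem_center (hZ : Nat.card (center G) = 2 * m) {t : G}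
    (ht : t ∈ center G) : t ^ (2 * m) = 1 := by
  have h : (⟨t, ht⟩ : center G) ^ (2 * m) = 1 := hZ ▸ pow_card_eq_one'
  exact congrArg Subtype.val h

theorem center_le_of_index_two (h4 : (center G).index ∣ 4) (hm : Odd m)
    (hZ : Nat.card (center G) = 2 * m) (hab : ¬ Commute a b) {H : Subgroup G}
    (hH : H.index = 2) : center G ≤ H := by
  intro t ht
  have htm : t ^ m ∈ H := by
    by_cases h1 : t ^ m = 1
    · exact h1 ▸ one_mem H
    · rw [eq_of_mem_center_of_sq_eq_one hm hZ (pow_mem ht m)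
        (commutatorElement_mem_center h4 hab) h1 (commutatorElement_ne_one hab)
        (by rw [← pow_mul, mul_comm, pow_two_mul_eq_one_of_mem_center hZ ht])
        (commutatorElement_sq_eq_one h4 hab)]
      exact commutatorElement_mem_of_index_two hH a b
  obtain ⟨k, rfl⟩ := hm
  rw [pow_succ, pow_mul] at htm
  exact (mul_mem_cancel_left (pow_mem (sq_mem_of_index_two hH t) k)).mp htm

theorem card_index_two_le_three (h4 : (center G).index ∣ 4) (hm : Odd m)
    (hZ : Nat.card (center G) = 2 * m) (hab : ¬ Commute a b) :
    Nat.card {H : Subgroup G // H.index = 2} ≤ 3 := by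
  classical
  have hmem : ∀ (H : Subgroup G), H.index = 2 → ∀ g x, g * x ∈ center G → (g ∈ H ↔ x ∈ H) :=
    fun H hH g x h ↦ (mul_mem_iff_of_index_two hH).mp (center_le_of_index_two h4 hm hZ hab hH h)
  let f : {H : Subgroup G // H.index = 2} → {p : Bool × Bool // p ≠ (true, true)} :=
    fun H ↦ ⟨(decide (a ∈ H.1), decide (b ∈ H.1)), fun h ↦ by
      simp only [Prod.mk.injEq, decide_eq_true_eq] at h
      have htop : H.1 = ⊤ := (eq_top_iff' _).mpr fun g ↦ by
        obtain ⟨x, hx, hgx⟩ := exists_mul_mem_center h4 hab g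
        rw [hmem H.1 H.2 g x hgx]
        rcases hx with rfl | rfl | rfl | rfl
        exacts [one_mem _, h.1, h.2, mul_mem h.1 h.2]
      have := H.2
      rw [htop, index_top] at this
      omega⟩
  have hf : Function.Injective f := by
    rintro ⟨H, hH⟩ ⟨K, hK⟩ h
    simp only [f, Subtype.mk.injEq, Prod.mk.injEq, decide_eq_decide] at h
    refine Subtype.ext (Subgroup.ext fun g ↦ ?_)
    obtain ⟨x, hx, hgx⟩ := exists_mul_mem_center h4 hab g
    rw [hmem H hH g x hgx, hmem K hK g x hgx]
    rcases hx with rfl | rfl | rfl | rfl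
    · simp
    · exact h.1
    · exact h.2
    · rw [mul_mem_iff_of_index_two hH, mul_mem_iff_of_index_two hK, h.1, h.2]
  refine (Nat.card_le_card_of_injective f hf).trans ?_
  rw [Nat.card_eq_fintype_card]
  decide

theorem one_lt_card_index_two [Finite G] (h4 : (center G).index ∣ 4) (hab : ¬ Commute a b) :
    1 < Nat.card {H : Subgroup G // H.index = 2} := by
  rw [Finite.one_lt_card_iff_nontrivial]
  refine ⟨⟨_, index_centralizer_eq_two h4 hab⟩,
    ⟨_, index_centralizer_eq_two h4 fun h ↦ hab h.symm⟩, fun h ↦ hab ?_⟩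
  have h' : centralizer {a} = centralizer {b} := congrArg Subtype.val h
  exact mem_centralizer_singleton_iff.mp (h' ▸ mem_centralizer_singleton_iff.mpr rfl)

theorem exists_not_commute_sq_eq_one (h4 : (center G).index ∣ 4) (hm : Odd m)
    (hZ : Nat.card (center G) = 2 * m) {g : G} (hg : g ∉ center G) (hg2 : g ^ 2 = 1) :
    ∃ d, ¬ Commute g d ∧ d ^ 2 = 1 := by
  obtain ⟨c, hc⟩ : ∃ c, ¬ Commute g c := by
    by_contra! h
    exact hg (mem_center_iff.mpr fun x ↦ (h x).symm)
  obtain ⟨d, hd, hd4⟩ : ∃ d, ¬ Commute g d ∧ (d ^ 2) ^ 2 = 1 := by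
    refine ⟨c ^ m, fun h ↦ hc ?_, ?_⟩
    · obtain ⟨k, rfl⟩ := hm
      have hk : (c ^ 2) ^ k ∈ center G := pow_mem (sq_mem_center h4 hc c) k
      have hcomm : Commute g ((c ^ 2) ^ k)⁻¹ := mem_center_iff.mp (inv_mem hk) g
      have := hcomm.mul_right h
      rwa [pow_succ c (2 * k), pow_mul c 2, inv_mul_cancel_left] at this
    · rw [← pow_two_mul_eq_one_of_mem_center hZ (sq_mem_center h4 hc c)]
      simp only [← pow_mul]
      congr 1
      ring
  by_cases h1 : d ^ 2 = 1
  · exact ⟨d, hd, h1⟩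
  refine ⟨g * d, fun h ↦ hd ?_, ?_⟩
  · simpa using ((Commute.refl g).inv_right).mul_right h
  have hz := commutatorElement_mem_center h4 hd
  have hdz := eq_of_mem_center_of_sq_eq_one hm hZ (sq_mem_center h4 hd d) hz h1
    (commutatorElement_ne_one hd) hd4 (commutatorElement_sq_eq_one h4 hd)
  have hginv : g⁻¹ = g := inv_eq_of_mul_eq_one_left (by rw [← pow_two, hg2])
  have hcd : ⁅g, d⁆ * d ^ 2 = (g * d) ^ 2 := by
    rw [commutatorElement_def, hginv, pow_two, pow_two]
    group
  rw [← hcd, hdz, ← pow_two, commutatorElement_sq_eq_one h4 hd]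

theorem three_lt_card_orderOf_eq_two [Finite G] (h4 : (center G).index ∣ 4) (hab : ¬ Commute a b)
    (ha : a ^ 2 = 1) (hb : b ^ 2 = 1) : 3 < Nat.card {g : G // orderOf g = 2} := by
  classical
  have hz := commutatorElement_mem_center h4 hab
  have hz1 := commutatorElement_ne_one hab
  have hz2 := commutatorElement_sq_eq_one h4 hab
  set z := ⁅a, b⁆
  have hcomm : ∀ g, Commute g z := fun g ↦ mem_center_iff.mp hz g
  have hsub : (({z, a, a * z, b} : Finset G) : Set G) ⊆ {g | orderOf g = 2} := by
    intro g hg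
    simp only [Finset.coe_insert, Finset.coe_singleton, Set.mem_insert_iff,
      Set.mem_singleton_iff] at hg
    refine orderOf_eq_prime_iff.mpr ?_
    rcases hg with rfl | rfl | rfl | rfl
    · exact ⟨hz2, hz1⟩
    · exact ⟨ha, by rintro rfl; exact hab (Commute.one_left b)⟩
    · refine ⟨by rw [(hcomm a).mul_pow, ha, hz2, one_mul], fun h ↦ hab ?_⟩
      rw [mul_eq_one_iff_eq_inv.mp h]
      exact ((hcomm b).inv_right).symm
    · exact ⟨hb, by rintro rfl; exact hab (Commute.one_right a)⟩
  have hcard : ({z, a, a * z, b} : Finset G).card = 4 := by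
    have hza : z ≠ a := fun h ↦ hab (h ▸ (hcomm b).symm)
    have hzb : z ≠ b := fun h ↦ hab (h ▸ hcomm a)
    have hzaz : z ≠ a * z := fun h ↦ hab (right_eq_mul.mp h ▸ Commute.one_left b)
    have haaz : a ≠ a * z := fun h ↦ hz1 (left_eq_mul.mp h)
    have hne : a ≠ b := fun h ↦ hab (h ▸ Commute.refl a)
    have hazb : a * z ≠ b := fun h ↦ hab (h ▸ (Commute.refl a).mul_right (hcomm a))
    simp [*]
  have hle := Set.ncard_le_ncard hsub (Set.toFinite _)
  rw [Set.ncard_coe_finset, hcard] at hle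
  exact hle

theorem card_orderOf_eq_two_le_one_or_three_lt [Finite G] (h4 : (center G).index ∣ 4)
    (hm : Odd m) (hZ : Nat.card (center G) = 2 * m) :
    Nat.card {g : G // orderOf g = 2} ≤ 1 ∨ 3 < Nat.card {g : G // orderOf g = 2} := by
  by_cases h : ∃ g ∉ center G, g ^ 2 = 1
  · obtain ⟨g, hg, hg2⟩ := h
    obtain ⟨d, hd, hd2⟩ := exists_not_commute_sq_eq_one h4 hm hZ hg hg2
    exact .inr (three_lt_card_orderOf_eq_two h4 hd hg2 hd2)
  · push Not at h
    left
    rw [Finite.card_le_one_iff_subsingleton]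
    refine ⟨fun ⟨s, hs⟩ ⟨t, ht⟩ ↦ Subtype.ext ?_⟩
    obtain ⟨hs2, hs1⟩ := orderOf_eq_prime_iff.mp hs
    obtain ⟨ht2, ht1⟩ := orderOf_eq_prime_iff.mp ht
    exact eq_of_mem_center_of_sq_eq_one hm hZ (by_contra fun hn ↦ h s hn hs2)
      (by_contra fun hn ↦ h t hn ht2) hs1 ht1 hs2 ht2

end CenterIndex

theorem subCount_card_div_two {G : Type*} [Group G] [Finite G] (h : 2 ∣ Nat.card G) :
    subCount G (Nat.card G / 2) = Nat.card {H : Subgroup G // H.index = 2} := by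
  refine Nat.card_congr (Equiv.subtypeEquivRight fun H ↦ ?_)
  have hmul := H.card_mul_index
  have hpos : 0 < Nat.card H := Nat.card_pos
  obtain ⟨k, hk⟩ := h
  rw [hk, Nat.mul_div_cancel_left _ two_pos]
  rw [hk] at hmul
  constructor
  · rintro rfl
    exact Nat.eq_of_mul_eq_mul_left hpos (by linarith)
  · intro h
    rw [h] at hmul
    omega

/-- If `N` is a positive integer with `v_p(N) ≤ 2` for every odd prime `p` and
`v_2(N) ≤ 3`, and `G` is a nilpotent group of order `N`, then the symmetry
`a_d(G) = a_{N/d}(G)` for all positive divisors `d` of `N` (i.e. the symmetry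
`ζ_G(s) = N^{-s} ζ_G(-s)`) holds iff `G` is abelian. -/
theorem stmt_9 (N : ℕ) (hN : 0 < N)
    (hodd : ∀ p : ℕ, p.Prime → Odd p → N.factorization p ≤ 2)
    (h2 : N.factorization 2 ≤ 3)
    (G : Type*) [Group G] [Finite G] [Group.IsNilpotent G]
    (hG : Nat.card G = N) :
    (∀ d : ℕ, d ∣ N → subCount G d = subCount G (N / d)) ↔
      (∀ a b : G, a * b = b * a) := by
  subst hG
  constructor
  · intro h a b
    by_contra hab
    have h4 := index_center_dvd_four hodd h2
    have hcard := (center G).card_mul_index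
    rw [index_center_eq_four h4 hab] at hcard
    have h2N : 2 ∣ Nat.card G := ⟨2 * Nat.card (center G), by omega⟩
    obtain ⟨m, hm⟩ := prime_dvd_card_center_of_dvd_card h2N
    have hmodd : Odd m := by
      by_contra hn
      obtain ⟨k, rfl⟩ := even_iff_exists_two_mul.mp (Nat.not_odd_iff_even.mp hn)
      have h16 : 2 ^ 4 ∣ Nat.card G := ⟨k, by omega⟩
      have := (Nat.prime_two.pow_dvd_iff_le_factorization hN.ne').mp h16
      omega
    have heq := h 2 h2N
    rw [subCount_two, subCount_card_div_two h2N] at heq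
    have hle := card_index_two_le_three h4 hmodd hm hab
    have hlt := one_lt_card_index_two h4 hab
    have := card_orderOf_eq_two_le_one_or_three_lt h4 hmodd hm
    omega
  · intro h d hd
    let _ : CommGroup G := { ‹Group G› with mul_comm := h }
    exact subCount_eq_subCount_div_of_commGroup hd
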